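/- Let q = 2^m with m even, m ≥ 4. Then (U_{q+1}, B_{σ_{6,3},q+1}) is a 3-(q+1, 6, (q−4)²/6) design. -/

import Mathlib

open Finset

/-- The `l`-th elementary symmetric polynomial evaluated on a finite set `B`. -/
noncomputable def esym {F : Type*} [CommRing F] (B : Finset F) (l : ℕ) : F :=
  ∑ s ∈ B.powersetCard l, ∏ x ∈ s, x

/-- The set of `n`-th roots of unity. -/
def rootsSet (F : Type*) [Monoid F] (n : ℕ) : Set F := {u | u ^ n = 1}

theorem esym_zero {F : Type*} [CommRing F] (B : Finset F) : esym B 0 = 1 := by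
  simp [esym]

theorem esym_empty_succ {F : Type*} [CommRing F] (l : ℕ) : esym (∅ : Finset F) (l + 1) = 0 := by
  rw [esym, powersetCard_eq_empty.2 (by simp), sum_empty]

theorem esym_insert_succ {F : Type*} [CommRing F] [DecidableEq F] {a : F} {B : Finset F}
    (ha : a ∉ B) (l : ℕ) : esym (insert a B) (l + 1) = esym B (l + 1) + a * esym B l := by
  unfold esym
  rw [powersetCard_succ_insert ha, sum_union, sum_image, mul_sum]
  · congr 1
    refine sum_congr rfl fun s hs => prod_insert fun h => ha ((mem_powersetCard.1 hs).1 h)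
  · intro s hs t ht h
    have hs' : a ∉ s := fun h => ha ((mem_powersetCard.1 hs).1 h)
    have ht' : a ∉ t := fun h => ha ((mem_powersetCard.1 ht).1 h)
    rw [← erase_insert hs', ← erase_insert ht', h]
  · rw [disjoint_left]
    intro s hs hs'
    obtain ⟨t, -, rfl⟩ := mem_image.1 hs'
    exact ha ((mem_powersetCard.1 hs).1 (mem_insert_self a t))

/-- The third elementary symmetric polynomial in six variables. -/
def sigmaSixThree {K : Type*} [CommRing K] (x y z u v w : K) : K :=
  x * y * z + x * y * u + x * y * v + x * y * w + x * z * u + x * z * v + x * z * w +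
    x * u * v + x * u * w + x * v * w + y * z * u + y * z * v + y * z * w + y * u * v +
    y * u * w + y * v * w + z * u * v + z * u * w + z * v * w + u * v * w

theorem esym_three_of_six {K : Type*} [CommRing K] [DecidableEq K] {x y z u v w : K}
    (h : #({x, y, z, u, v, w} : Finset K) = 6) :
    esym {x, y, z, u, v, w} 3 = sigmaSixThree x y z u v w := by
  have hcard (a : K) (s : Finset K) (n : ℕ) (hs : #s ≤ n) (h : #(insert a s) = n + 1) :
      a ∉ s ∧ #s = n := by
    by_cases ha : a ∈ s
    · rw [insert_eq_of_mem ha] at h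
      lia
    · rw [card_insert_of_notMem ha] at h
      exact ⟨ha, by lia⟩
  obtain ⟨hx, h⟩ := hcard _ _ 5 card_le_five h
  obtain ⟨hy, h⟩ := hcard _ _ 4 card_le_four h
  obtain ⟨hz, h⟩ := hcard _ _ 3 card_le_three h
  obtain ⟨hu, h⟩ := hcard _ _ 2 card_le_two h
  obtain ⟨hv, h⟩ := hcard _ _ 1 (by simp) h
  have e (n : ℕ) : esym {w} (n + 1) = 0 + w * esym ∅ n := by
    rw [← esym_empty_succ (F := K) n, ← esym_insert_succ (notMem_empty w), insert_empty_eq]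
  have e0 := esym_zero (∅ : Finset K)
  have e1 : esym (∅ : Finset K) 1 = 0 := esym_empty_succ 0
  have e2 : esym (∅ : Finset K) 2 = 0 := esym_empty_succ 1
  have hsucc {a : K} {s : Finset K} (ha : a ∉ s) :
      esym (insert a s) 3 = esym s 3 + a * esym s 2 ∧
      esym (insert a s) 2 = esym s 2 + a * esym s 1 ∧
      esym (insert a s) 1 = esym s 1 + a * esym s 0 :=
    ⟨esym_insert_succ ha 2, esym_insert_succ ha 1, esym_insert_succ ha 0⟩
  have ew1 := e 0
  have ew2 := e 1
  have ew3 := e 2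
  simp only [zero_add, Nat.reduceAdd] at ew1 ew2 ew3
  simp only [hsucc hx, hsucc hy, hsucc hz, hsucc hu, hsucc hv, ew1, ew2, ew3, e0, e1, e2,
    esym_zero, sigmaSixThree]
  ring

theorem cross_ratio_identity {K : Type*} [Field K] [CharP K 2] (x y z u v w : K) :
    (z - x) * ((u - x) * (v - y) * (w - y) + (u - y) * (v - x) * (w - y) +
        (u - y) * (v - y) * (w - x)) +
      (z - y) * ((u - x) * (v - x) * (w - y) + (u - x) * (v - y) * (w - x) +
        (u - y) * (v - x) * (w - x)) =
    (x - y) * sigmaSixThree x y z u v w := by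
  unfold sigmaSixThree
  grind

theorem cross_ratio_symm_eq_zero_iff {K : Type*} [Field K] [CharP K 2] {x y z u v w a b c : K}
    (hxy : x ≠ y) (hxz : x ≠ z) (hyz : y ≠ z) (hu : u ≠ y) (hv : v ≠ y) (hw : w ≠ y)
    (ha : a * ((z - x) * (u - y)) = (u - x) * (z - y))
    (hb : b * ((z - x) * (v - y)) = (v - x) * (z - y))
    (hc : c * ((z - x) * (w - y)) = (w - x) * (z - y)) :
    sigmaSixThree x y z u v w = 0 ↔ a + b + c + a * b + a * c + b * c = 0 := by
  have hzx : z - x ≠ 0 := sub_ne_zero.2 hxz.symm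
  have hzy : z - y ≠ 0 := sub_ne_zero.2 hyz.symm
  have hu' := mul_ne_zero hzx (sub_ne_zero.2 hu)
  have hv' := mul_ne_zero hzx (sub_ne_zero.2 hv)
  have hw' := mul_ne_zero hzx (sub_ne_zero.2 hw)
  have key : (a + b + c + a * b + a * c + b * c) *
      (((z - x) * (u - y)) * ((z - x) * (v - y)) * ((z - x) * (w - y))) =
      ((z - y) * (z - x) * (x - y)) * sigmaSixThree x y z u v w := by
    rw [mul_assoc _ (x - y), ← cross_ratio_identity]
    generalize hU : (z - x) * (u - y) = U at *
    generalize hV : (z - x) * (v - y) = V at *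
    generalize hW : (z - x) * (w - y) = W at *
    calc _ = (a * U) * V * W + (b * V) * U * W + (c * W) * U * V + (a * U) * (b * V) * W +
          (a * U) * (c * W) * V + (b * V) * (c * W) * U := by ring
      _ = _ := by
        rw [ha, hb, hc, ← hU, ← hV, ← hW]
        ring
  rw [← mul_eq_zero_iff_left (mul_ne_zero (mul_ne_zero hzy hzx) (sub_ne_zero.2 hxy)),
    mul_comm _ (sigmaSixThree _ _ _ _ _ _), mul_comm (sigmaSixThree _ _ _ _ _ _), ← key]
  simp [hu', hv', hw']

theorem exists_param_roots {F K : Type*} [Field F] [Field K] [CharP K 2] {m : ℕ} (e : F →+* K)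
    (he : ∀ t : K, t ^ 2 ^ m = t ↔ ∃ a, e a = t) {x y z : K} (hx : x ^ (2 ^ m + 1) = 1)
    (hy : y ^ (2 ^ m + 1) = 1) (hz : z ^ (2 ^ m + 1) = 1) (hxy : x ≠ y) (hxz : x ≠ z)
    (hyz : y ≠ z) :
    ∃ f : F → K, Function.Injective f ∧ (∀ a, f a ^ (2 ^ m + 1) = 1) ∧ (∀ a, f a ≠ y) ∧
      (∀ u, u ^ (2 ^ m + 1) = 1 → u ≠ y → ∃ a, f a = u) ∧ f 0 = x ∧ f 1 = z ∧
      ∀ a b c, sigmaSixThree x y z (f a) (f b) (f c) = 0 ↔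
        a + b + c + a * b + a * c + b * c = 0 := by
  have hzx : z - x ≠ 0 := sub_ne_zero.2 hxz.symm
  have hzy : z - y ≠ 0 := sub_ne_zero.2 hyz.symm
  have hyx : y - x ≠ 0 := sub_ne_zero.2 hxy.symm
  have ne_zero {u : K} (hu : u ^ (2 ^ m + 1) = 1) : u ≠ 0 := by
    rintro rfl
    simp at hu
  obtain ⟨σ, hσ⟩ : ∃ σ : K →+* K, ∀ u, σ u = u ^ 2 ^ m :=
    ⟨iterateFrobenius K 2 m, fun u => iterateFrobenius_def 2 m u⟩
  have hinv {u : K} (hu : u ^ (2 ^ m + 1) = 1) : σ u = u⁻¹ := by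
    rw [hσ]
    exact eq_inv_of_mul_eq_one_left (by rwa [← pow_succ])
  have hx0 := ne_zero hx
  have hy0 := ne_zero hy
  have hz0 := ne_zero hz
  have hd {t : K} (ht : σ t = t) : (z - y) - t * (z - x) ≠ 0 := by
    intro h
    have h1 : σ ((z - y) - t * (z - x)) * (x * y * z) = -(x * (z - y) - t * (z - x) * y) := by
      simp only [map_sub, map_mul, hinv hx, hinv hy, hinv hz, ht]
      field_simp
      ring
    rw [h, map_zero, zero_mul] at h1
    have h2 : t * ((z - x) * (y - x)) = 0 := by linear_combination x * h - h1
    have h3 : t = 0 := (mul_eq_zero.1 h2).resolve_right (mul_ne_zero hzx hyx)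
    rw [h3] at h
    exact hzy (by linear_combination h)
  have heσ (a : F) : σ (e a) = e a := by rw [hσ, he]; exact ⟨a, rfl⟩
  have hrel {t u : K} (ht : σ t = t) :
      u = (x * (z - y) - t * (z - x) * y) / ((z - y) - t * (z - x)) ↔
      t * ((z - x) * (u - y)) = (u - x) * (z - y) := by
    rw [eq_div_iff (hd ht)]
    constructor <;> intro h <;> linear_combination -h
  let f (a : F) : K := (x * (z - y) - e a * (z - x) * y) / ((z - y) - e a * (z - x))
  have hf (a : F) : e a * ((z - x) * (f a - y)) = (f a - x) * (z - y) := (hrel (heσ a)).1 rfl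
  have hfy (a : F) : f a ≠ y := by
    intro h
    have h1 := hf a
    rw [h, sub_self, mul_zero, mul_zero] at h1
    exact mul_ne_zero hyx hzy h1.symm
  refine ⟨f, ?_, ?_, hfy, ?_, ?_, ?_, ?_⟩
  · intro a b h
    have h1 := (hf a).trans (h ▸ (hf b).symm)
    rw [h] at h1
    exact e.injective (mul_right_cancel₀ (mul_ne_zero hzx (sub_ne_zero.2 (hfy b))) h1)
  · intro a
    have h1 : σ ((z - y) - e a * (z - x)) = -(x * (z - y) - e a * (z - x) * y) / (x * y * z) := by
      simp only [map_sub, map_mul, hinv hx, hinv hy, hinv hz, heσ]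
      field_simp
      ring
    have h2 : σ (x * (z - y) - e a * (z - x) * y) = -((z - y) - e a * (z - x)) / (x * y * z) := by
      simp only [map_sub, map_mul, hinv hx, hinv hy, hinv hz, heσ]
      field_simp
      ring
    have h3 := hd (heσ a)
    have h4 : x * (z - y) - e a * (z - x) * y ≠ 0 := by
      intro h
      rw [h, neg_zero, zero_div, map_eq_zero] at h1
      exact h3 h1
    rw [pow_succ, ← hσ]
    simp only [f]
    rw [map_div₀, h1, h2]
    generalize x * (z - y) - e a * (z - x) * y = n at *
    generalize (z - y) - e a * (z - x) = d at *
    field_simp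
  · intro u hu huy
    have hu0 := ne_zero hu
    have huy' := sub_ne_zero.2 huy
    have hσt : σ ((u - x) * (z - y) / ((z - x) * (u - y))) =
        (u - x) * (z - y) / ((z - x) * (u - y)) := by
      simp only [map_div₀, map_sub, map_mul, hinv hx, hinv hy, hinv hz, hinv hu]
      have e1 : (z⁻¹ - x⁻¹) = -(z - x) / (x * z) := by field_simp; ring
      have e2 : (u⁻¹ - y⁻¹) = -(u - y) / (u * y) := by field_simp; ring
      have e3 : (u⁻¹ - x⁻¹) = -(u - x) / (u * x) := by field_simp; ring
      have e4 : (z⁻¹ - y⁻¹) = -(z - y) / (z * y) := by field_simp; ring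
      rw [e1, e2, e3, e4]
      field_simp
    obtain ⟨a, ha⟩ := (he _).1 ((hσ _).symm.trans hσt)
    refine ⟨a, ((hrel (heσ a)).2 ?_).symm⟩
    rw [ha, div_mul_cancel₀ _ (mul_ne_zero hzx huy')]
  · simp [f, hzy]
  · simp only [f, map_one]
    rw [div_eq_iff (by rw [one_mul, sub_sub_sub_cancel_left]; exact sub_ne_zero.2 hxy)]
    ring
  · intro a b c
    rw [cross_ratio_symm_eq_zero_iff hxy hxz hyz (hfy a) (hfy b) (hfy c) (hf a) (hf b) (hf c)]
    simp only [← map_mul, ← map_add, map_eq_zero]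

theorem exists_subfield_hom {m : ℕ} (hm : m ≠ 0) :
    ∃ e : GaloisField 2 m →+* GaloisField 2 (2 * m),
      ∀ t : GaloisField 2 (2 * m), t ^ 2 ^ m = t ↔ ∃ a, e a = t := by
  have hm2 : 2 * m ≠ 0 := by lia
  obtain ⟨φ⟩ := FiniteField.nonempty_algHom_of_finrank_dvd (F := ZMod 2) (K := GaloisField 2 m)
    (L := GaloisField 2 (2 * m))
    (by rw [GaloisField.finrank 2 hm, GaloisField.finrank 2 hm2]; exact dvd_mul_left m 2)
  have : Fintype (GaloisField 2 m) := Fintype.ofFinite _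
  have hcard : Fintype.card (GaloisField 2 m) = 2 ^ m := by
    rw [← Nat.card_eq_fintype_card, GaloisField.card 2 m hm]
  refine ⟨φ, fun t => ⟨fun ht => ?_, ?_⟩⟩
  · classical
    by_contra! hne
    let p : Polynomial (GaloisField 2 (2 * m)) := .X ^ 2 ^ m - .X
    have hq : 1 < 2 ^ m := Nat.one_lt_two_pow hm
    have hp : p ≠ 0 := FiniteField.X_pow_card_sub_X_ne_zero _ hq
    have hsub : insert t (univ.image φ) ⊆ p.roots.toFinset := by
      intro s hs
      rw [Multiset.mem_toFinset, Polynomial.mem_roots hp]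
      simp only [p, Polynomial.IsRoot.def, Polynomial.eval_sub,
        Polynomial.eval_pow, Polynomial.eval_X, sub_eq_zero]
      obtain rfl | hs := mem_insert.1 hs
      · exact ht
      · obtain ⟨a, -, rfl⟩ := mem_image.1 hs
        rw [← map_pow, ← hcard, FiniteField.pow_card]
    have h1 := card_le_card hsub
    have hφ : Function.Injective φ := φ.toRingHom.injective
    rw [card_insert_of_notMem (by simpa using hne), card_image_of_injective univ hφ,
      card_univ, hcard] at h1
    have h2 := (Multiset.toFinset_card_le p.roots).trans p.card_roots'
    rw [FiniteField.X_pow_card_sub_X_natDegree_eq _ hq] at h2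
    lia
  · rintro ⟨a, rfl⟩
    rw [← map_pow, ← hcard, FiniteField.pow_card]

theorem card_image_triple {α : Type*} [DecidableEq α] (S : Finset (α × α × α))
    (hne : ∀ a b c, (a, b, c) ∈ S → a ≠ b ∧ a ≠ c ∧ b ≠ c)
    (hswap : ∀ a b c, (a, b, c) ∈ S → (b, a, c) ∈ S)
    (hrot : ∀ a b c, (a, b, c) ∈ S → (b, c, a) ∈ S) :
    #S = 6 * #(S.image fun t => ({t.1, t.2.1, t.2.2} : Finset α)) := by
  rw [card_eq_sum_card_image (fun t => ({t.1, t.2.1, t.2.2} : Finset α)) S, mul_comm]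
  refine sum_const_nat fun T hT => ?_
  obtain ⟨⟨a, b, c⟩, h, rfl⟩ := mem_image.1 hT
  obtain ⟨hab, hac, hbc⟩ := hne a b c h
  have hfiber : {t ∈ S | ({t.1, t.2.1, t.2.2} : Finset α) = {a, b, c}} =
      {(a, b, c), (a, c, b), (b, a, c), (b, c, a), (c, a, b), (c, b, a)} := by
    ext ⟨u, v, w⟩
    simp only [mem_filter, mem_insert, mem_singleton, Prod.mk.injEq]
    constructor
    · rintro ⟨hS, hT⟩
      obtain ⟨huv, huw, hvw⟩ := hne u v w hS
      have hu : u ∈ ({a, b, c} : Finset α) := hT ▸ by simp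
      have hv : v ∈ ({a, b, c} : Finset α) := hT ▸ by simp
      have hw : w ∈ ({a, b, c} : Finset α) := hT ▸ by simp
      simp only [mem_insert, mem_singleton] at hu hv hw
      grind
    · have h1 := hrot _ _ _ h
      have h2 := hrot _ _ _ h1
      rintro (⟨rfl, rfl, rfl⟩ | ⟨rfl, rfl, rfl⟩ | ⟨rfl, rfl, rfl⟩ | ⟨rfl, rfl, rfl⟩ |
        ⟨rfl, rfl, rfl⟩ | ⟨rfl, rfl, rfl⟩)
      all_goals
        refine ⟨by first | assumption | exact hswap _ _ _ ‹_›, ?_⟩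
        ext t
        simp only [mem_insert, mem_singleton]
        try tauto
  rw [hfiber]
  simp [hab, hac, hbc, hab.symm, hac.symm, hbc.symm]

theorem sum_ite_mem_zero_one {α : Type*} [Fintype α] [DecidableEq α] (S : Finset α) :
    ∑ b, (if b ∈ S then 0 else 1) = #Sᶜ := by
  have h : Sᶜ = ({b | b ∉ S} : Finset α) := by ext; simp
  rw [h, card_filter]
  simp_rw [ite_not]

/-- Ordered triples of distinct elements `a, b, c` other than `0, 1` with
`a + b + c + a * b + a * c + b * c = 0`. -/
def symmTriples (F : Type*) [Field F] [Fintype F] [DecidableEq F] : Finset (F × F × F) :=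
  {t | t.1 ≠ 0 ∧ t.1 ≠ 1 ∧ t.2.1 ≠ 0 ∧ t.2.1 ≠ 1 ∧ t.2.2 ≠ 0 ∧ t.2.2 ≠ 1 ∧
    t.1 ≠ t.2.1 ∧ t.1 ≠ t.2.2 ∧ t.2.1 ≠ t.2.2 ∧
    t.1 + t.2.1 + t.2.2 + t.1 * t.2.1 + t.1 * t.2.2 + t.2.1 * t.2.2 = 0}

section SymmTriples

variable {F : Type*} [Field F] [Fintype F] [DecidableEq F]

theorem mem_symmTriples {a b c : F} : (a, b, c) ∈ symmTriples F ↔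
    a ≠ 0 ∧ a ≠ 1 ∧ b ≠ 0 ∧ b ≠ 1 ∧ c ≠ 0 ∧ c ≠ 1 ∧ a ≠ b ∧ a ≠ c ∧ b ≠ c ∧
      a + b + c + a * b + a * c + b * c = 0 := by
  simp [symmTriples]

theorem card_symmTriples_eq_sum :
    #(symmTriples F) = ∑ a, ∑ b, #{c | (a, b, c) ∈ symmTriples F} := by
  have h : symmTriples F = ({t | t ∈ symmTriples F} : Finset (F × F × F)) := by simp
  rw [h, card_filter, Fintype.sum_prod_type]
  simp_rw [Fintype.sum_prod_type, card_filter]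
  simp

theorem card_third_eq_zero_or_one [CharP F 2] {a b : F} (hab : a + b + 1 ≠ 0) :
    #{c | (a, b, c) ∈ symmTriples F} =
      if a = 0 ∨ a = 1 ∨ b = 0 ∨ b = 1 ∨ a = b ∨ a * b + a + b = 0 ∨ a * b = 1 ∨ b = a ^ 2 ∨
        a = b ^ 2 then 0 else 1 := by
  have key (c : F) : a + b + c + a * b + a * c + b * c = 0 ↔
      c * (a + b + 1) = a * b + a + b := by
    clear hab
    grind
  have hcancel (c t : F) : c = t ↔ c * (a + b + 1) = t * (a + b + 1) :=
    (mul_left_inj' hab).symm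
  have hmem (c : F) : (a, b, c) ∈ symmTriples F ↔ (a ≠ 0 ∧ a ≠ 1 ∧ b ≠ 0 ∧ b ≠ 1 ∧ a ≠ b ∧
      a * b + a + b ≠ 0 ∧ a * b ≠ 1 ∧ b ≠ a ^ 2 ∧ a ≠ b ^ 2) ∧
      c * (a + b + 1) = a * b + a + b := by
    rw [mem_symmTriples, key, ne_eq c, ne_eq c, ne_eq a c, ne_eq b c, eq_comm (a := a) (b := c),
      eq_comm (a := b) (b := c)]
    by_cases h : c * (a + b + 1) = a * b + a + b
    · rw [hcancel c 0, hcancel c 1, hcancel c a, hcancel c b, h]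
      have e1 : a * b + a + b = 0 * (a + b + 1) ↔ a * b + a + b = 0 := by simp
      have e2 : a * b + a + b = 1 * (a + b + 1) ↔ a * b = 1 := by clear hab; grind
      have e3 : a * b + a + b = a * (a + b + 1) ↔ b = a ^ 2 := by clear hab; grind
      have e4 : a * b + a + b = b * (a + b + 1) ↔ a = b ^ 2 := by clear hab; grind
      rw [e1, e2, e3, e4]
      tauto
    · tauto
  simp_rw [hmem]
  split_ifs with h
  · rw [card_eq_zero, filter_eq_empty_iff]
    tauto
  · rw [card_eq_one]
    refine ⟨(a * b + a + b) / (a + b + 1), ?_⟩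
    ext c
    rw [mem_filter, mem_singleton, eq_div_iff hab]
    simp only [mem_univ, true_and]
    tauto

theorem sum_card_third_generic [CharP F 2] {s : F} (h0 : s ≠ 0) (h1 : s ≠ 1)
    (h2 : s ^ 2 + s + 1 ≠ 0) :
    ∑ b, #{c | (s ^ 2, b, c) ∈ symmTriples F} = Fintype.card F - 8 := by
  have hs1 : s + 1 ≠ 0 := by grind
  have hs2 : s ^ 2 + 1 ≠ 0 := by grind
  have hs3 : s ^ 2 ≠ 0 := pow_ne_zero 2 h0
  have hprod : (s * (s + 1) * (s ^ 2 + s + 1)) ^ 4 ≠ 0 :=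
    pow_ne_zero 4 (mul_ne_zero (mul_ne_zero h0 hs1) h2)
  have hb (b : F) : #{c | (s ^ 2, b, c) ∈ symmTriples F} =
      if b ∈ ({0, 1, s ^ 2, s ^ 2 + 1, s ^ 2 / (s ^ 2 + 1), 1 / s ^ 2, s ^ 4, s} : Finset F)
        then 0 else 1 := by
    by_cases hb : s ^ 2 + b + 1 = 0
    · rw [if_pos (by simp only [mem_insert]; grind), card_eq_zero, filter_eq_empty_iff]
      intro c _ hc
      rw [mem_symmTriples] at hc
      obtain ⟨-, -, -, -, -, -, -, -, -, h⟩ := hc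
      refine hprod ?_
      clear hprod h0 h1 h2 hs1 hs2 hs3
      grind
    · rw [card_third_eq_zero_or_one hb]
      refine if_congr ?_ rfl rfl
      simp only [mem_insert, mem_singleton, eq_div_iff hs2, eq_div_iff hs3]
      have e1 : s ^ 2 = 1 ↔ False := iff_false_intro fun h => hs2 (by clear hprod; grind)
      have e2 : s ^ 2 = b ^ 2 ↔ b = s := by
        refine ⟨fun h => ?_, fun h => by rw [h]⟩
        have : (b - s) ^ 2 = 0 := by clear hprod h0 h1 h2 hs1 hs2 hs3 hb; grind
        exact sub_eq_zero.1 (pow_eq_zero_iff two_ne_zero |>.1 this)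
      have e3 : s ^ 2 * b + s ^ 2 + b = 0 ↔ b * (s ^ 2 + 1) = s ^ 2 := by
        clear hprod h0 h1 h2 hs1 hs2 hs3 hb; grind
      have e4 : b = s ^ 2 + 1 ↔ False := iff_false_intro fun h => hb (by clear hprod; grind)
      have e5 : b = (s ^ 2) ^ 2 ↔ b = s ^ 4 := by rw [← pow_mul]
      rw [e1, e2, e3, e4, e5, mul_comm b (s ^ 2), eq_comm (a := s ^ 2) (b := b)]
      simp only [hs3, false_or]
  have hc : #({0, 1, s ^ 2, s ^ 2 + 1, s ^ 2 / (s ^ 2 + 1), 1 / s ^ 2, s ^ 4, s} : Finset F) =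
      8 := by
    repeat rw [card_insert_of_notMem]
    · simp
    all_goals
      simp only [mem_insert, mem_singleton, eq_div_iff hs2, eq_div_iff hs3,
        div_eq_iff hs2, div_eq_iff hs3]
      refine fun h => hprod ?_
      clear hprod h0 h1 h2 hs1 hs2 hs3 hb
      grind
  simp_rw [hb]
  rw [sum_ite_mem_zero_one, card_compl, hc]

theorem sum_card_third_special [CharP F 2] {a : F} (ha : a ^ 2 + a + 1 = 0) :
    ∑ b, #{c | (a, b, c) ∈ symmTriples F} = 2 * (Fintype.card F - 4) := by
  have h1 : (1 : F) ≠ 0 := one_ne_zero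
  have hQ : #({0, 1, a, a + 1} : Finset F) = 4 := by
    repeat rw [card_insert_of_notMem]
    · simp
    all_goals
      simp only [mem_insert, mem_singleton]
      refine fun h => h1 ?_
      clear h1
      grind
  have hb (b : F) : #{c | (a, b, c) ∈ symmTriples F} =
      (if b ∈ ({0, 1, a, a + 1} : Finset F) then 0 else 1) +
        if b = a + 1 then Fintype.card F - 4 else 0 := by
    by_cases hb : b = a + 1
    · subst hb
      rw [if_pos (by simp), if_pos rfl, zero_add, ← hQ, ← card_compl]
      congr 1
      ext c
      have ha0 : a ≠ 0 := fun h => h1 (by clear h1; grind)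
      have ha1 : a ≠ 1 := fun h => h1 (by clear h1; grind)
      have hb1 : a + 1 ≠ 0 := fun h => h1 (by clear h1 ha0 ha1; grind)
      have hr : a + (a + 1) + c + a * (a + 1) + a * c + (a + 1) * c = 0 := by
        clear h1 ha0 ha1 hb1; grind
      simp only [mem_filter, mem_univ, true_and, mem_symmTriples, mem_compl, mem_insert,
        mem_singleton, hr]
      simp only [ne_eq, ha0, ha1, hb1, add_eq_right, left_eq_add, one_ne_zero, eq_comm (b := c)]
      tauto
    · have hs : a + b + 1 ≠ 0 := fun h => hb (by clear h1 hb; grind)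
      rw [card_third_eq_zero_or_one hs, if_neg hb, add_zero]
      refine if_congr ?_ rfl rfl
      simp only [mem_insert, mem_singleton, hb, or_false]
      have ha0 : a ≠ 0 := fun h => h1 (by clear h1 hb hs; grind)
      have ha1 : a ≠ 1 := fun h => h1 (by clear h1 hb hs; grind)
      have e1 : a * b + a + b ≠ 0 := fun h => hb (by
        have : a ^ 2 * b + a ^ 2 + a * b = 0 := by linear_combination a * h
        clear h1 hb hs ha0 ha1; grind)
      have e2 : a * b ≠ 1 := fun h => hb (by
        have : a ^ 2 * b = a := by linear_combination a * h
        clear h1 hb hs ha0 ha1; grind)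
      have e3 : b ≠ a ^ 2 := fun h => hb (by clear h1 hb hs ha0 ha1 e1 e2; grind)
      have e4 : a ≠ b ^ 2 := fun h => hb (by
        have : (b - (a + 1)) ^ 2 = 0 := by clear h1 hb hs ha0 ha1 e1 e2 e3; grind
        exact sub_eq_zero.1 (pow_eq_zero_iff two_ne_zero |>.1 this))
      simp only [ha0, ha1, e1, e2, e3, e4, false_or, or_false, eq_comm (a := a)]
  simp_rw [hb]
  rw [sum_add_distrib, sum_ite_mem_zero_one, card_compl, hQ, sum_ite_eq' univ (a + 1),
    if_pos (mem_univ _), two_mul]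

theorem card_symmTriples [CharP F 2] (h3 : 3 ∣ Fintype.card F - 1) (h8 : 8 ≤ Fintype.card F) :
    #(symmTriples F) = (Fintype.card F - 4) ^ 2 := by
  obtain ⟨ω, hω⟩ : ∃ ω : F, ω ^ 2 + ω + 1 = 0 := by
    rw [← Fintype.card_units] at h3
    obtain ⟨u, hu⟩ := exists_prime_orderOf_dvd_card 3 h3
    have hu3 : (u : F) ^ 3 = 1 := by
      rw [← Units.val_pow_eq_pow_val, ← hu, pow_orderOf_eq_one, Units.val_one]
    have hu1 : (u : F) - 1 ≠ 0 := by
      rw [sub_ne_zero, ne_eq, Units.val_eq_one]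
      rintro rfl
      simp at hu
    exact ⟨u, (mul_eq_zero.1 (by linear_combination hu3 :
      ((u : F) - 1) * ((u : F) ^ 2 + u + 1) = 0)).resolve_left hu1⟩
  have h1 : (1 : F) ≠ 0 := one_ne_zero
  have hQ : #({0, 1, ω, ω + 1} : Finset F) = 4 := by
    repeat rw [card_insert_of_notMem]
    · simp
    all_goals
      simp only [mem_insert, mem_singleton]
      refine fun h => h1 ?_
      clear h1
      grind
  have hω' : (ω + 1) ^ 2 + (ω + 1) + 1 = 0 := by clear h1; grind
  have hgen : ∀ a ∈ ({0, 1, ω, ω + 1} : Finset F)ᶜ,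
      ∑ b, #{c | (a, b, c) ∈ symmTriples F} = Fintype.card F - 8 := by
    intro a ha
    simp only [mem_compl, mem_insert, mem_singleton, not_or] at ha
    obtain ⟨ha0, ha1, haω, haω'⟩ := ha
    obtain ⟨s, rfl⟩ := FiniteField.isSquare_of_char_two (ringChar.eq F 2) a
    rw [← pow_two] at *
    refine sum_card_third_generic (by rintro rfl; simp at ha0) (by rintro rfl; simp at ha1) ?_
    intro h
    have : (s ^ 2 - ω) * (s ^ 2 - (ω + 1)) = 0 := by clear h1 ha0 ha1 haω haω'; grind
    exact (mul_ne_zero (sub_ne_zero.2 haω) (sub_ne_zero.2 haω')) this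
  have h0 (a : F) (ha : a = 0 ∨ a = 1) : ∑ b, #{c | (a, b, c) ∈ symmTriples F} = 0 := by
    refine sum_eq_zero fun b _ => card_eq_zero.2 (filter_eq_empty_iff.2 fun c _ => ?_)
    rw [mem_symmTriples]
    tauto
  have hS : ∑ a ∈ ({0, 1, ω, ω + 1} : Finset F), ∑ b, #{c | (a, b, c) ∈ symmTriples F} =
      4 * (Fintype.card F - 4) := by
    repeat rw [sum_insert]
    · rw [sum_singleton, h0 0 (.inl rfl), h0 1 (.inr rfl), sum_card_third_special hω,
        sum_card_third_special hω']
      ring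
    all_goals
      simp only [mem_insert, mem_singleton]
      refine fun h => h1 ?_
      clear h1 h0 hgen
      grind
  rw [card_symmTriples_eq_sum, ← sum_add_sum_compl ({0, 1, ω, ω + 1} : Finset F), hS,
    sum_congr rfl hgen, sum_const, card_compl, hQ, smul_eq_mul]
  obtain ⟨k, hk⟩ := Nat.exists_eq_add_of_le h8
  rw [hk, show 8 + k - 4 = k + 4 by lia, show 8 + k - 8 = k by lia]
  ring

end SymmTriples

/-- The unordered sets underlying `symmTriples`. -/
def symmTripleSets (F : Type*) [Field F] [Fintype F] [DecidableEq F] : Finset (Finset F) :=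
  (symmTriples F).image fun t => {t.1, t.2.1, t.2.2}

theorem card_symmTripleSets {F : Type*} [Field F] [Fintype F] [DecidableEq F] [CharP F 2]
    (h3 : 3 ∣ Fintype.card F - 1) (h8 : 8 ≤ Fintype.card F) :
    #(symmTripleSets F) = (Fintype.card F - 4) ^ 2 / 6 := by
  rw [← card_symmTriples h3 h8, card_image_triple (symmTriples F), symmTripleSets]
  · lia
  · intro a b c h
    rw [mem_symmTriples] at h
    tauto
  · intro a b c h
    rw [mem_symmTriples] at h ⊢
    obtain ⟨ha, ha1, hb, hb1, hc, hc1, hab, hac, hbc, h⟩ := h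
    exact ⟨hb, hb1, ha, ha1, hc, hc1, hab.symm, hbc, hac, by linear_combination h⟩
  · intro a b c h
    rw [mem_symmTriples] at h ⊢
    obtain ⟨ha, ha1, hb, hb1, hc, hc1, hab, hac, hbc, h⟩ := h
    exact ⟨hb, hb1, hc, hc1, ha, ha1, hbc, hab.symm, hac.symm, by linear_combination h⟩

theorem mem_symmTripleSets {F : Type*} [Field F] [Fintype F] [DecidableEq F] {T : Finset F} :
    T ∈ symmTripleSets F ↔ ∃ a b c, (a, b, c) ∈ symmTriples F ∧ {a, b, c} = T := by
  simp [symmTripleSets]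

theorem stmt9 (m : ℕ) (hm : 4 ≤ m) (heven : Even m)
    (E : Finset (GaloisField 2 (2 * m)))
    (hEU : ↑E ⊆ rootsSet (GaloisField 2 (2 * m)) (2 ^ m + 1))
    (hE : E.card = 3) :
    {B : Finset (GaloisField 2 (2 * m)) |
        ↑B ⊆ rootsSet (GaloisField 2 (2 * m)) (2 ^ m + 1) ∧ B.card = 6 ∧
          esym B 3 = 0 ∧ E ⊆ B}.ncard = (2 ^ m - 4) ^ 2 / 6 := by
  classical
  obtain ⟨x, y, z, hxy, hxz, hyz, rfl⟩ := card_eq_three.1 hE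
  have hU : ∀ u ∈ ({x, y, z} : Finset (GaloisField 2 (2 * m))), u ^ (2 ^ m + 1) = 1 :=
    fun u hu => hEU hu
  obtain ⟨e, he⟩ := exists_subfield_hom (m := m) (by lia)
  obtain ⟨f, hinj, hfU, hfy, hfsurj, hf0, hf1, hσ⟩ := exists_param_roots e he (hU x (by simp))
    (hU y (by simp)) (hU z (by simp)) hxy hxz hyz
  have : Fintype (GaloisField 2 m) := Fintype.ofFinite _
  have hcard : Fintype.card (GaloisField 2 m) = 2 ^ m := by
    rw [← Nat.card_eq_fintype_card, GaloisField.card 2 m (by lia)]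
  have h3 : 3 ∣ Fintype.card (GaloisField 2 m) - 1 := by
    obtain ⟨k, rfl⟩ := heven
    rw [hcard, ← two_mul, pow_mul]
    simpa using Nat.sub_dvd_pow_sub_pow 4 1 k
  have h8 : 8 ≤ Fintype.card (GaloisField 2 m) := by
    rw [hcard]
    exact (show 8 ≤ 2 ^ 4 by norm_num).trans (Nat.pow_le_pow_right two_pos hm)
  have hcount := card_symmTripleSets h3 h8
  rw [hcard] at hcount
  rw [← hcount, ← Set.ncard_coe_finset]
  symm
  have hfx {t : GaloisField 2 m} (ht : t ≠ 0) : f t ≠ x :=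
    fun h => ht (hinj (h.trans hf0.symm))
  have hfz {t : GaloisField 2 m} (ht : t ≠ 1) : f t ≠ z :=
    fun h => ht (hinj (h.trans hf1.symm))
  have hdisj (T) (hT : T ∈ symmTripleSets (GaloisField 2 m)) :
      Disjoint {x, y, z} (T.image f) := by
    obtain ⟨a, b, c, habc, rfl⟩ := mem_symmTripleSets.1 hT
    obtain ⟨ha0, ha1, hb0, hb1, hc0, hc1, -⟩ := mem_symmTriples.1 habc
    rw [disjoint_right]
    intro u hu
    obtain ⟨t, ht, rfl⟩ := mem_image.1 hu
    simp only [mem_insert, mem_singleton] at ht ⊢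
    obtain rfl | rfl | rfl := ht <;> simp [*]
  refine Set.ncard_congr (fun T _ => {x, y, z} ∪ T.image f) ?_ ?_ ?_
  · intro T hT
    have hd := hdisj T hT
    obtain ⟨a, b, c, habc, rfl⟩ := mem_symmTripleSets.1 hT
    obtain ⟨-, -, -, -, -, -, hab, hac, hbc, h⟩ := mem_symmTriples.1 habc
    have h6 : #({x, y, z} ∪ image f {a, b, c}) = 6 := by
      rw [card_union_of_disjoint hd, hE, card_image_of_injective _ hinj,
        card_eq_three.2 ⟨a, b, c, hab, hac, hbc, rfl⟩]
    refine ⟨?_, h6, ?_, subset_union_left⟩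
    · intro u hu
      obtain hu | hu := mem_union.1 hu
      · exact hU u hu
      · obtain ⟨t, -, rfl⟩ := mem_image.1 hu
        exact hfU t
    · have hB : {x, y, z} ∪ image f {a, b, c} = {x, y, z, f a, f b, f c} := by
        simp only [image_insert, image_singleton, insert_union, singleton_union]
      rw [hB] at h6 ⊢
      rw [esym_three_of_six h6, hσ, h]
  · intro S T hS hT h
    have h' : S.image f = T.image f := by
      rw [← union_sdiff_cancel_left (hdisj S hS), h, union_sdiff_cancel_left (hdisj T hT)]
    exact image_injective hinj h'
  · rintro B ⟨hBU, hB6, hB0, hEB⟩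
    have hcs : #(B \ {x, y, z}) = 3 := by rw [card_sdiff_of_subset hEB, hB6, hE]
    obtain ⟨u, v, w, huv, huw, hvw, hB⟩ := card_eq_three.1 hcs
    have hpre : ∀ t ∈ B \ {x, y, z}, ∃ a, a ≠ 0 ∧ a ≠ 1 ∧ f a = t := by
      intro t ht
      simp only [mem_sdiff, mem_insert, mem_singleton, not_or] at ht
      obtain ⟨a, rfl⟩ := hfsurj t (hBU ht.1) ht.2.2.1
      refine ⟨a, ?_, ?_, rfl⟩
      · rintro rfl
        exact ht.2.1 hf0
      · rintro rfl
        exact ht.2.2.2 hf1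
    obtain ⟨a, ha0, ha1, rfl⟩ := hpre u (by simp [hB])
    obtain ⟨b, hb0, hb1, rfl⟩ := hpre v (by simp [hB])
    obtain ⟨c, hc0, hc1, rfl⟩ := hpre w (by simp [hB])
    have hBeq : B = {x, y, z, f a, f b, f c} := by
      rw [← union_sdiff_of_subset hEB, hB]
      simp only [insert_union, singleton_union]
    refine ⟨{a, b, c}, mem_symmTripleSets.2 ⟨a, b, c, mem_symmTriples.2 ?_, rfl⟩, ?_⟩
    · refine ⟨ha0, ha1, hb0, hb1, hc0, hc1, hinj.ne_iff.1 huv, hinj.ne_iff.1 huw,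
        hinj.ne_iff.1 hvw, ?_⟩
      rw [hBeq] at hB6 hB0
      rw [← hσ, ← esym_three_of_six hB6, hB0]
    · rw [hBeq]
      simp only [image_insert, image_singleton, insert_union, singleton_union]
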